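/- There exists a 150 × 150 matrix with all entries in {+1, −1} whose determinant has absolute value 2^75 · 149 · 74^74, i.e., a D-optimal design of order 150 exists. -/

import Mathlib

/-!
The design is `[[A, B], [-Bᵀ, Aᵀ]]`, where `A`, `B` are group-circulant `±1` matrices over
`ℤ₅ × ℤ₅ × ℤ₃` coming from a pair of supplementary difference sets with
parameters `(75; 36, 29; 28)`, found by computer.  The sets are encoded as bit masks.
-/

/-- The group of order 75. -/
abbrev G75 : Type := ZMod 5 × ZMod 5 × ZMod 3

/-- Sign function on the group encoded by a bit mask. -/
def sgn75 (m : ℕ) (g : G75) : ℤ :=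
  bif m.testBit ((g.1.val * 5 + g.2.1.val) * 3 + g.2.2.val) then -1 else 1

/-- First block. -/
def seqA : G75 → ℤ := sgn75 16646928071730736521375

/-- Second block. -/
def seqB : G75 → ℤ := sgn75 14389639083921292761181

theorem sgn75_eq (m : ℕ) (g : G75) : sgn75 m g = 1 ∨ sgn75 m g = -1 := by
  unfold sgn75
  cases m.testBit ((g.1.val * 5 + g.2.1.val) * 3 + g.2.2.val) <;> simp

set_option maxRecDepth 100000 in
theorem paf : ∀ g : G75, (∑ x, seqA (g - x) * seqA (-x)) + (∑ x, seqB (g - x) * seqB (-x))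
    = if g = 0 then 150 else 2 := by
  decide +kernel

open Matrix

theorem gram75 : circulant seqA * (circulant seqA)ᵀ + circulant seqB * (circulant seqB)ᵀ
    = Matrix.of (fun i j : G75 => if i = j then (150 : ℤ) else 2) := by
  rw [transpose_circulant, transpose_circulant, circulant_mul, circulant_mul, ← circulant_add]
  ext i j
  rw [circulant_apply]
  have h := paf (i - j)
  simp only [Pi.add_apply, mulVec, dotProduct, circulant_apply]
  rw [h]
  by_cases hij : i = j
  · subst hij; simp
  · simp [hij, sub_eq_zero]

theorem det_gram : (Matrix.of (fun i j : G75 => if i = j then (150 : ℤ) else 2)).det = 2 ^ 75 * 149 * 74 ^ 74 := by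
  have hinj : Function.Injective (Int.castRingHom ℚ) := Int.cast_injective
  apply hinj
  rw [RingHom.map_det]
  have : (Int.castRingHom ℚ).mapMatrix (Matrix.of (fun i j : G75 => if i = j then (150 : ℤ) else 2)) =
      (148 : ℚ) • (1 + replicateCol Unit (fun _ : G75 => (1 / 74 : ℚ)) *
        replicateRow Unit (fun _ : G75 => (1 : ℚ))) := by
    ext i j
    by_cases hij : i = j
    · subst hij; simp [Matrix.mul_apply]; norm_num
    · simp [Matrix.mul_apply, hij]; norm_num
  rw [this, det_smul, det_one_add_replicateCol_mul_replicateRow]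
  have hc : Fintype.card G75 = 75 := by simp [G75, ZMod.card]
  rw [hc]
  simp only [dotProduct, Finset.sum_const, Finset.card_univ, hc]
  norm_num

theorem big_det : (fromBlocks (circulant seqA) (circulant seqB)
    (-(circulant seqB)ᵀ) (circulant seqA)ᵀ).det.natAbs = 2 ^ 75 * 149 * 74 ^ 74 := by
  set A := circulant seqA with hA
  set B := circulant seqB with hB
  set M := fromBlocks A B (-Bᵀ) Aᵀ with hM
  have cAB : A * B = B * A := circulant_mul_comm _ _
  have cAA : Aᵀ * A = A * Aᵀ := by
    rw [hA, transpose_circulant]; exact circulant_mul_comm _ _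
  have cBB : Bᵀ * B = B * Bᵀ := by
    rw [hB, transpose_circulant]; exact circulant_mul_comm _ _
  have cT : Bᵀ * Aᵀ = Aᵀ * Bᵀ := by
    rw [← transpose_mul, ← transpose_mul, cAB]
  have h : M * Mᵀ = fromBlocks (A * Aᵀ + B * Bᵀ) 0 0 (A * Aᵀ + B * Bᵀ) := by
    rw [hM, fromBlocks_transpose, fromBlocks_multiply]
    congr 1
    · simp [cAB]
    · simp [cT]
    · simp [cAA, cBB, add_comm]
  have h2 := congrArg det h
  rw [det_mul, det_transpose, det_fromBlocks_zero₂₁, gram75, det_gram] at h2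
  have h3 := Int.natAbs_eq_iff_mul_self_eq.mpr h2
  rw [h3]
  norm_num

/-- A D-optimal design of order 150 exists: there is a 150×150 matrix with entries
in {+1, −1} whose determinant has absolute value 2^75 · 149 · 74^74,
the Ehlich–Wojtas bound for order 2v = 150. -/
theorem doptimal_design_order_150 :
    ∃ A : Matrix (Fin 150) (Fin 150) ℤ,
      (∀ i j, A i j = 1 ∨ A i j = -1) ∧
      A.det.natAbs = 2 ^ 75 * 149 * 74 ^ 74 := by
  have hc : Fintype.card (G75 ⊕ G75) = 150 := by simp [G75, ZMod.card]
  let e := Fintype.equivFinOfCardEq hc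
  refine ⟨(fromBlocks (circulant seqA) (circulant seqB)
    (-(circulant seqB)ᵀ) (circulant seqA)ᵀ).submatrix e.symm e.symm, ?_, ?_⟩
  · intro i j
    rw [submatrix_apply]
    have hA : ∀ g, seqA g = 1 ∨ seqA g = -1 := sgn75_eq _
    have hB : ∀ g, seqB g = 1 ∨ seqB g = -1 := sgn75_eq _
    rcases e.symm i with x | x <;> rcases e.symm j with y | y
    · simpa using hA (x - y)
    · simpa using hB (x - y)
    · have := hB (y - x)
      simp only [fromBlocks_apply₂₁, neg_apply, transpose_apply, circulant_apply]
      omega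
    · simpa using hA (y - x)
  · rw [det_submatrix_equiv_self]
    exact big_det
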